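/- Let N ≥ 2 and let a ≥ 0 be a constant. There exist ε > 0 and C > 0, depending only on N and a, such that every C² function u : Q₄ → ℝ with u ≥ 0 on Q₄ and −Δu(x) + a·u(x) ≥ 0 for all x ∈ Q₄ satisfies inf_{x ∈ Q₁} u(x)/x_N ≥ C · ( ∫_{Q₁} ( u(x)/x_N )^ε dx )^{1/ε}. -/

import Mathlib

open MeasureTheory Metric Set

/-- The Laplacian of a real-valued function on `ℝ^N`, as the sum of second
partial derivatives in the coordinate directions. -/
noncomputable def lap {N : ℕ} (u : EuclideanSpace ℝ (Fin N) → ℝ)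
    (x : EuclideanSpace ℝ (Fin N)) : ℝ :=
  ∑ i : Fin N, fderiv ℝ (fun y => fderiv ℝ u y (EuclideanSpace.single i 1)) x
    (EuclideanSpace.single i 1)

/-- The open cube `Q_ρ(y)` of center `y` and side length `ρ`. -/
def cube {N : ℕ} (ρ : ℝ) (y : EuclideanSpace ℝ (Fin N)) :
    Set (EuclideanSpace ℝ (Fin N)) :=
  {x | ∀ i : Fin N, |x i - y i| < ρ / 2}

section Product

variable {N : ℕ}

lemma hasFDerivAt_prod_coord (g g' : Fin N → ℝ → ℝ) (x : EuclideanSpace ℝ (Fin N))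
    (h : ∀ i, HasDerivAt (g i) (g' i (x i)) (x i)) :
    HasFDerivAt (fun y : EuclideanSpace ℝ (Fin N) => ∏ i, g i (y i))
      (∑ i, (∏ j ∈ Finset.univ.erase i, g j (x j)) •
        (g' i (x i) • (EuclideanSpace.proj i : EuclideanSpace ℝ (Fin N) →L[ℝ] ℝ))) x := by
  refine HasFDerivAt.finsetProd (u := Finset.univ)
    (g := fun i (y : EuclideanSpace ℝ (Fin N)) => g i (y i)) fun i _ => ?_
  exact (h i).comp_hasFDerivAt x
    (EuclideanSpace.proj i : EuclideanSpace ℝ (Fin N) →L[ℝ] ℝ).hasFDerivAt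

lemma fderiv_prod_coord_single (g g' : Fin N → ℝ → ℝ) (x : EuclideanSpace ℝ (Fin N))
    (h : ∀ i, HasDerivAt (g i) (g' i (x i)) (x i)) (i : Fin N) :
    fderiv ℝ (fun y : EuclideanSpace ℝ (Fin N) => ∏ i, g i (y i)) x (EuclideanSpace.single i 1) =
      (∏ j ∈ Finset.univ.erase i, g j (x j)) * g' i (x i) := by
  rw [(hasFDerivAt_prod_coord g g' x h).fderiv]
  simp [PiLp.single_apply]

lemma fderiv_prod_coord_single_eq_prod (g g' : Fin N → ℝ → ℝ)
    (h : ∀ i t, HasDerivAt (g i) (g' i t) t) (i : Fin N) :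
    (fun x => fderiv ℝ (fun y : EuclideanSpace ℝ (Fin N) => ∏ i, g i (y i)) x
      (EuclideanSpace.single i 1)) = fun x => ∏ j, Function.update g i (g' i) j (x j) := by
  funext x
  rw [fderiv_prod_coord_single g g' x (fun i => h i _) i,
    ← Finset.prod_erase_mul _ _ (Finset.mem_univ i), Function.update_self]
  congr 1
  refine Finset.prod_congr rfl fun j hj => ?_
  rw [Function.update_of_ne (Finset.ne_of_mem_erase hj)]

lemma hasDerivAt_update_apply {g g' : Fin N → ℝ → ℝ} {i : Fin N} {k k' : ℝ → ℝ}
    (h : ∀ i t, HasDerivAt (g i) (g' i t) t) (hk : ∀ t, HasDerivAt k (k' t) t) (j : Fin N) (t : ℝ) :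
    HasDerivAt (Function.update g i k j) (Function.update g' i k' j t) t := by
  rcases eq_or_ne j i with rfl | hj
  · simpa using hk t
  · simpa [hj] using h j t

lemma fderiv_fderiv_prod_coord_single (g g' g'' : Fin N → ℝ → ℝ)
    (h : ∀ i t, HasDerivAt (g i) (g' i t) t) (h' : ∀ i t, HasDerivAt (g' i) (g'' i t) t)
    (x : EuclideanSpace ℝ (Fin N)) (i : Fin N) :
    fderiv ℝ (fun x => fderiv ℝ (fun y : EuclideanSpace ℝ (Fin N) => ∏ i, g i (y i)) x
      (EuclideanSpace.single i 1)) x (EuclideanSpace.single i 1) =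
      (∏ j ∈ Finset.univ.erase i, g j (x j)) * g'' i (x i) := by
  rw [fderiv_prod_coord_single_eq_prod g g' h i,
    fderiv_prod_coord_single _ (Function.update g' i (g'' i)) x
      (fun j => hasDerivAt_update_apply h (h' i) j _) i, Function.update_self]
  congr 1
  refine Finset.prod_congr rfl fun j hj => ?_
  rw [Function.update_of_ne (Finset.ne_of_mem_erase hj)]

lemma lap_prod_coord (g g' g'' : Fin N → ℝ → ℝ)
    (h : ∀ i t, HasDerivAt (g i) (g' i t) t) (h' : ∀ i t, HasDerivAt (g' i) (g'' i t) t)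
    (x : EuclideanSpace ℝ (Fin N)) :
    lap (fun y : EuclideanSpace ℝ (Fin N) => ∏ i, g i (y i)) x =
      ∑ i, (∏ j ∈ Finset.univ.erase i, g j (x j)) * g'' i (x i) :=
  Finset.sum_congr rfl fun i _ => fderiv_fderiv_prod_coord_single g g' g'' h h' x i

lemma lap_prod_coord_ge {g g' g'' : Fin N → ℝ → ℝ}
    (h : ∀ i t, HasDerivAt (g i) (g' i t) t) (h' : ∀ i t, HasDerivAt (g' i) (g'' i t) t)
    {x : EuclideanSpace ℝ (Fin N)} (hpos : ∀ i, 0 ≤ g i (x i)) {k : Fin N → ℝ}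
    (hk : ∀ i, k i * g i (x i) ≤ g'' i (x i)) :
    (∑ i, k i) * ∏ i, g i (x i) ≤ lap (fun y : EuclideanSpace ℝ (Fin N) => ∏ i, g i (y i)) x := by
  rw [lap_prod_coord g g' g'' h h', Finset.sum_mul]
  refine Finset.sum_le_sum fun i _ => ?_
  rw [← Finset.prod_erase_mul _ _ (Finset.mem_univ i)]
  have := mul_le_mul_of_nonneg_left (hk i)
    (Finset.prod_nonneg fun j (_ : j ∈ Finset.univ.erase i) => hpos j)
  linarith

lemma contDiff_prod_coord {n : WithTop ℕ∞} {g : Fin N → ℝ → ℝ} (h : ∀ i, ContDiff ℝ n (g i)) :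
    ContDiff ℝ n (fun y : EuclideanSpace ℝ (Fin N) => ∏ i, g i (y i)) :=
  contDiff_prod fun i _ => (h i).comp
    (EuclideanSpace.proj i : EuclideanSpace ℝ (Fin N) →L[ℝ] ℝ).contDiff

lemma sum_ite_exists_ge {p : Fin N → Prop} [DecidablePred p] {K L : ℝ} (hK : 0 ≤ K) (hL : 0 ≤ L)
    (hp : ∃ i, p i) : K - N * L ≤ ∑ i, if p i then K else -L := by
  obtain ⟨i, hi⟩ := hp
  have h1 : ∀ j, (if j = i then K else 0) + -L ≤ if p j then K else -L := by
    intro j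
    by_cases hj : j = i
    · subst hj; simp [hi, hL]
    · by_cases hpj : p j <;> simp [hj, hpj]; linarith
  calc K - N * L = ∑ j, ((if j = i then K else 0) + -L) := by
        simp [Finset.sum_add_distrib]; ring
    _ ≤ _ := Finset.sum_le_sum fun j _ => h1 j

end Product

section Profile

lemma hasDerivAt_max_zero_pow (k : ℕ) (x : ℝ) :
    HasDerivAt (fun y : ℝ => max y 0 ^ (k + 2)) ((k + 2) * max x 0 ^ (k + 1)) x := by
  rcases lt_trichotomy x 0 with hx | rfl | hx
  · rw [max_eq_right hx.le]
    have : HasDerivAt (fun _ : ℝ => (0 : ℝ)) 0 x := hasDerivAt_const _ _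
    refine (this.congr_of_eventuallyEq ?_).congr_deriv (by simp)
    filter_upwards [eventually_lt_nhds hx] with y hy
    simp [max_eq_right hy.le]
  · rw [hasDerivAt_iff_isLittleO]
    simp only [max_self, ne_eq, Nat.add_eq_zero_iff, OfNat.ofNat_ne_zero, and_false,
      not_false_eq_true, zero_pow, sub_zero, one_ne_zero, mul_zero, smul_zero]
    have h1 : (fun y : ℝ => max y 0 ^ (k + 2)) =O[nhds 0] fun y => y ^ (k + 2) := by
      refine Asymptotics.IsBigO.of_bound 1 (Filter.Eventually.of_forall fun y => ?_)
      rw [one_mul, norm_pow, norm_pow]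
      refine pow_le_pow_left₀ (norm_nonneg _) ?_ _
      rcases le_total y 0 with hy | hy <;> simp [hy]
    exact h1.trans_isLittleO (Asymptotics.isLittleO_pow_id (by omega))
  · rw [max_eq_left hx.le]
    refine ((hasDerivAt_pow (k + 2) x).congr_of_eventuallyEq ?_).congr_deriv (by simp)
    filter_upwards [eventually_gt_nhds hx] with y hy
    simp [max_eq_left hy.le]

/-- One-dimensional factor of the barrier: a bump vanishing linearly at `± τ`. -/
noncomputable def barrier (α τ t : ℝ) : ℝ := (τ ^ 2 - t ^ 2) * Real.exp (-α * t ^ 2)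

/-- One-dimensional factor of the test function: a `C²` bump supported in `[-τ, τ]`. -/
noncomputable def testBump (α τ t : ℝ) : ℝ := max (τ ^ 2 - t ^ 2) 0 ^ 3 * Real.exp (-α * t ^ 2)

noncomputable def barrierDeriv (α τ t : ℝ) : ℝ :=
  (-2 * t - 2 * α * t * (τ ^ 2 - t ^ 2)) * Real.exp (-α * t ^ 2)

noncomputable def barrierDeriv2 (α τ t : ℝ) : ℝ :=
  (8 * α * t ^ 2 - 2 + (4 * α ^ 2 * t ^ 2 - 2 * α) * (τ ^ 2 - t ^ 2)) * Real.exp (-α * t ^ 2)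

noncomputable def testBumpDeriv (α τ t : ℝ) : ℝ :=
  (-6 * t * max (τ ^ 2 - t ^ 2) 0 ^ 2 - 2 * α * t * max (τ ^ 2 - t ^ 2) 0 ^ 3) *
    Real.exp (-α * t ^ 2)

noncomputable def testBumpDeriv2 (α τ t : ℝ) : ℝ :=
  (24 * t ^ 2 * max (τ ^ 2 - t ^ 2) 0 + (24 * α * t ^ 2 - 6) * max (τ ^ 2 - t ^ 2) 0 ^ 2 +
    (4 * α ^ 2 * t ^ 2 - 2 * α) * max (τ ^ 2 - t ^ 2) 0 ^ 3) * Real.exp (-α * t ^ 2)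

variable (α τ : ℝ)

lemma hasDerivAt_exp_neg_mul_sq (t : ℝ) :
    HasDerivAt (fun t : ℝ => Real.exp (-α * t ^ 2)) (-2 * α * t * Real.exp (-α * t ^ 2)) t := by
  refine (((hasDerivAt_pow 2 t).const_mul (-α)).exp).congr_deriv ?_
  push_cast; ring

lemma hasDerivAt_sq_sub_sq (t : ℝ) : HasDerivAt (fun t : ℝ => τ ^ 2 - t ^ 2) (-2 * t) t := by
  refine ((hasDerivAt_pow 2 t).const_sub (τ ^ 2)).congr_deriv ?_
  push_cast; ring

lemma hasDerivAt_max_sq_sub_sq_pow (k : ℕ) (t : ℝ) :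
    HasDerivAt (fun t : ℝ => max (τ ^ 2 - t ^ 2) 0 ^ (k + 2))
      ((k + 2) * max (τ ^ 2 - t ^ 2) 0 ^ (k + 1) * (-2 * t)) t :=
  HasDerivAt.comp (h₂ := fun y : ℝ => max y 0 ^ (k + 2)) t
    (hasDerivAt_max_zero_pow k (τ ^ 2 - t ^ 2)) (hasDerivAt_sq_sub_sq τ t)

lemma hasDerivAt_barrier (t : ℝ) : HasDerivAt (barrier α τ) (barrierDeriv α τ t) t := by
  refine ((hasDerivAt_sq_sub_sq τ t).mul (hasDerivAt_exp_neg_mul_sq α t)).congr_deriv ?_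
  simp only [barrierDeriv]; ring

lemma hasDerivAt_barrierDeriv (t : ℝ) :
    HasDerivAt (barrierDeriv α τ) (barrierDeriv2 α τ t) t := by
  refine (((((hasDerivAt_id t).const_mul (-2)).sub (((hasDerivAt_id t).const_mul (2 * α)).mul
    (hasDerivAt_sq_sub_sq τ t))).mul (hasDerivAt_exp_neg_mul_sq α t)).congr_deriv ?_)
  simp only [barrierDeriv2, Pi.sub_apply, Pi.mul_apply, id]; ring

lemma hasDerivAt_testBump (t : ℝ) : HasDerivAt (testBump α τ) (testBumpDeriv α τ t) t := by
  refine ((hasDerivAt_max_sq_sub_sq_pow τ 1 t).mul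
    (hasDerivAt_exp_neg_mul_sq α t)).congr_deriv ?_
  simp only [testBumpDeriv]; push_cast; ring

lemma hasDerivAt_testBumpDeriv (t : ℝ) :
    HasDerivAt (testBumpDeriv α τ) (testBumpDeriv2 α τ t) t := by
  refine (((((hasDerivAt_id t).const_mul (-6)).mul (hasDerivAt_max_sq_sub_sq_pow τ 0 t)).sub
    (((hasDerivAt_id t).const_mul (2 * α)).mul (hasDerivAt_max_sq_sub_sq_pow τ 1 t))).mul
    (hasDerivAt_exp_neg_mul_sq α t)).congr_deriv ?_
  simp only [testBumpDeriv2, Pi.sub_apply, Pi.mul_apply, id]; push_cast; ring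

lemma contDiff_barrier : ContDiff ℝ 2 (barrier α τ) := by
  unfold barrier; fun_prop

lemma continuous_testBumpDeriv2 : Continuous (testBumpDeriv2 α τ) := by
  unfold testBumpDeriv2; fun_prop

lemma contDiff_testBump : ContDiff ℝ 2 (testBump α τ) := by
  have h1 : deriv (testBump α τ) = testBumpDeriv α τ :=
    funext fun t => (hasDerivAt_testBump α τ t).deriv
  have h2 : deriv (testBumpDeriv α τ) = testBumpDeriv2 α τ :=
    funext fun t => (hasDerivAt_testBumpDeriv α τ t).deriv
  rw [show (2 : WithTop ℕ∞) = 1 + 1 by norm_num, contDiff_succ_iff_deriv, h1,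
    contDiff_one_iff_deriv,
    h2]
  exact ⟨fun t => (hasDerivAt_testBump α τ t).differentiableAt, by simp,
    fun t => (hasDerivAt_testBumpDeriv α τ t).differentiableAt, continuous_testBumpDeriv2 α τ⟩

variable {α τ} {r t : ℝ}

lemma testBump_nonneg : 0 ≤ testBump α τ t := by unfold testBump; positivity

lemma testBump_eq_zero (hτ : 0 ≤ τ) (ht : τ ≤ |t|) : testBump α τ t = 0 := by
  have : τ ^ 2 - t ^ 2 ≤ 0 := by
    rw [← sq_abs t]; nlinarith
  simp [testBump, max_eq_right this]

lemma barrier_nonneg (ht : |t| ≤ τ) : 0 ≤ barrier α τ t := by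
  have : t ^ 2 ≤ τ ^ 2 := sq_le_sq' (abs_le.1 ht).1 (abs_le.1 ht).2
  unfold barrier
  exact mul_nonneg (by linarith) (Real.exp_nonneg _)

lemma barrier_le (hα : 0 ≤ α) (h : |t| ≤ τ) (h2 : τ ≤ 2) : barrier α τ t ≤ 4 := by
  have ht : t ^ 2 ≤ τ ^ 2 := sq_le_sq' (abs_le.1 h).1 (abs_le.1 h).2
  have h0 : 0 ≤ τ := (abs_nonneg t).trans h
  have : Real.exp (-α * t ^ 2) ≤ 1 := Real.exp_le_one_iff.2 (by nlinarith [sq_nonneg t])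
  unfold barrier
  nlinarith [sq_nonneg t, Real.exp_nonneg (-α * t ^ 2)]

lemma testBump_le (hα : 0 ≤ α) (h0 : 0 ≤ τ) (h2 : τ ≤ 2) : testBump α τ t ≤ 64 := by
  have h1 : Real.exp (-α * t ^ 2) ≤ 1 := Real.exp_le_one_iff.2 (by nlinarith [sq_nonneg t])
  have h3 : max (τ ^ 2 - t ^ 2) 0 ≤ 4 := max_le (by nlinarith [sq_nonneg t]) (by norm_num)
  have h4 : max (τ ^ 2 - t ^ 2) 0 ^ 3 ≤ 4 ^ 3 := pow_le_pow_left₀ (le_max_right _ _) h3 3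
  unfold testBump
  nlinarith [pow_nonneg (le_max_right (τ ^ 2 - t ^ 2) 0) 3]

lemma barrierDeriv2_ge_of_le (hα : 0 ≤ α) (hαr : 1 ≤ 4 * α * r ^ 2) (hr : 0 ≤ r) (h : r ≤ |t|)
    (ht : |t| ≤ τ) : (4 * α ^ 2 * r ^ 2 - 2 * α) * barrier α τ t ≤ barrierDeriv2 α τ t := by
  have h1 : r ^ 2 ≤ t ^ 2 := by rw [← sq_abs t]; exact pow_le_pow_left₀ hr h 2
  have h2 : t ^ 2 ≤ τ ^ 2 := sq_le_sq' (abs_le.1 ht).1 (abs_le.1 ht).2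
  unfold barrier barrierDeriv2
  rw [← mul_assoc]
  refine mul_le_mul_of_nonneg_right ?_ (Real.exp_nonneg _)
  have h3 : α * r ^ 2 ≤ α * t ^ 2 := mul_le_mul_of_nonneg_left h1 hα
  have h4 : α ^ 2 * r ^ 2 ≤ α ^ 2 * t ^ 2 := mul_le_mul_of_nonneg_left h1 (sq_nonneg _)
  have h5 := mul_le_mul_of_nonneg_right h4 (sub_nonneg.2 h2)
  nlinarith

lemma barrierDeriv2_ge (hα : 0 ≤ α) (hαr : 1 ≤ 4 * α * r ^ 2) (hr : 0 ≤ r) (hr1 : r ≤ 1)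
    (hτ : 3 / 2 ≤ τ) (ht : |t| ≤ τ) : -(6 + 2 * α) * barrier α τ t ≤ barrierDeriv2 α τ t := by
  rcases le_total r |t| with h | h
  · refine le_trans ?_ (barrierDeriv2_ge_of_le hα hαr hr h ht)
    exact mul_le_mul_of_nonneg_right (by nlinarith [sq_nonneg (α * r)]) (barrier_nonneg ht)
  · have h2 : t ^ 2 ≤ 1 := by rw [← sq_abs t]; nlinarith [abs_nonneg t]
    have h3 : 1 ≤ τ ^ 2 - t ^ 2 := by nlinarith
    unfold barrier barrierDeriv2
    rw [← mul_assoc]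
    refine mul_le_mul_of_nonneg_right ?_ (Real.exp_nonneg _)
    have : 0 ≤ α ^ 2 * t ^ 2 * (τ ^ 2 - t ^ 2) := by positivity
    nlinarith [mul_nonneg hα (sq_nonneg t)]

lemma testBumpDeriv2_ge_of_le (hα : 0 ≤ α) (hαr : 1 ≤ 4 * α * r ^ 2) (hr : 0 ≤ r) (h : r ≤ |t|) :
    (4 * α ^ 2 * r ^ 2 - 2 * α) * testBump α τ t ≤ testBumpDeriv2 α τ t := by
  have h1 : r ^ 2 ≤ t ^ 2 := by rw [← sq_abs t]; exact pow_le_pow_left₀ hr h 2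
  unfold testBump testBumpDeriv2
  rw [← mul_assoc]
  refine mul_le_mul_of_nonneg_right ?_ (Real.exp_nonneg _)
  set q := max (τ ^ 2 - t ^ 2) 0 with hq
  have hq0 : 0 ≤ q := le_max_right _ _
  have h3 : α * r ^ 2 ≤ α * t ^ 2 := mul_le_mul_of_nonneg_left h1 hα
  have h4 : α ^ 2 * r ^ 2 ≤ α ^ 2 * t ^ 2 := mul_le_mul_of_nonneg_left h1 (sq_nonneg _)
  have h5 := mul_le_mul_of_nonneg_right h4 (pow_nonneg hq0 3)
  have h6 : 0 ≤ (24 * α * t ^ 2 - 6) * q ^ 2 := mul_nonneg (by linarith) (sq_nonneg _)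
  have h7 : 0 ≤ 24 * t ^ 2 * q := by positivity
  nlinarith

lemma testBumpDeriv2_ge (hα : 0 ≤ α) (hαr : 1 ≤ 4 * α * r ^ 2) (hr : 0 ≤ r) (hr1 : r ≤ 1)
    (hτ : 3 / 2 ≤ τ) : -(6 + 2 * α) * testBump α τ t ≤ testBumpDeriv2 α τ t := by
  rcases le_total r |t| with h | h
  · refine le_trans ?_ (testBumpDeriv2_ge_of_le hα hαr hr h)
    exact mul_le_mul_of_nonneg_right (by nlinarith [sq_nonneg (α * r)]) testBump_nonneg
  · have h2 : t ^ 2 ≤ 1 := by rw [← sq_abs t]; nlinarith [abs_nonneg t]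
    have h3 : 1 ≤ τ ^ 2 - t ^ 2 := by nlinarith
    unfold testBump testBumpDeriv2
    rw [← mul_assoc, max_eq_left (by linarith)]
    refine mul_le_mul_of_nonneg_right ?_ (Real.exp_nonneg _)
    set q := τ ^ 2 - t ^ 2
    have h4 : 0 ≤ α ^ 2 * t ^ 2 * q ^ 3 := by positivity
    have h5 : 0 ≤ t ^ 2 * q := by positivity
    have h6 : 0 ≤ α * t ^ 2 * q ^ 2 := by positivity
    have h7 : q ^ 2 ≤ q ^ 3 := pow_le_pow_right₀ h3 (by norm_num)
    nlinarith

lemma exists_barrier_exponent (A L r : ℝ) (hr : 0 < r) :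
    ∃ α : ℝ, 0 ≤ α ∧ 1 ≤ 4 * α * r ^ 2 ∧ A ≤ 4 * α ^ 2 * r ^ 2 - 2 * α - L * (6 + 2 * α) := by
  have hr2 : 0 < 4 * r ^ 2 := by positivity
  have hb : 0 < 1 + |A| + 8 * |L| := by positivity
  refine ⟨1 + (2 + 1 + |A| + 8 * |L|) / (4 * r ^ 2), by positivity, ?_, ?_⟩
  · have : (2 + 1 + |A| + 8 * |L|) / (4 * r ^ 2) * (4 * r ^ 2) = 2 + 1 + |A| + 8 * |L| :=
      div_mul_cancel₀ _ hr2.ne'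
    nlinarith [abs_nonneg A, abs_nonneg L]
  · set q := (2 + 1 + |A| + 8 * |L|) / (4 * r ^ 2) with hq
    have hq1 : q * (4 * r ^ 2) = 2 + 1 + |A| + 8 * |L| := div_mul_cancel₀ _ hr2.ne'
    have hq0 : 0 ≤ q := by positivity
    set α := 1 + q with hα
    have hα1 : 1 ≤ α := by linarith
    have h1 : 2 + 1 + |A| + 8 * |L| ≤ α * (4 * r ^ 2) := by nlinarith
    have h2 : α * (2 + 1 + |A| + 8 * |L|) ≤ α * (α * (4 * r ^ 2)) :=
      mul_le_mul_of_nonneg_left h1 (by linarith)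
    have h3 : |A| ≤ α * |A| := le_mul_of_one_le_left (abs_nonneg _) hα1
    have h4 : L * (6 + 2 * α) ≤ |L| * (6 + 2 * α) :=
      mul_le_mul_of_nonneg_right (le_abs_self L) (by linarith)
    have h5 : |L| ≤ α * |L| := le_mul_of_one_le_left (abs_nonneg _) hα1
    have h6 := le_abs_self A
    nlinarith

end Profile

section Analysis

variable {N : ℕ}

/-- The `i`-th partial derivative. -/
noncomputable def partialDeriv (i : Fin N) (f : EuclideanSpace ℝ (Fin N) → ℝ)
    (x : EuclideanSpace ℝ (Fin N)) : ℝ :=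
  fderiv ℝ f x (EuclideanSpace.single i 1)

lemma lap_eq_sum_partialDeriv (f : EuclideanSpace ℝ (Fin N) → ℝ) (x : EuclideanSpace ℝ (Fin N)) :
    lap f x = ∑ i, partialDeriv i (partialDeriv i f) x := rfl

lemma contDiff_partialDeriv {m n : WithTop ℕ∞} {f : EuclideanSpace ℝ (Fin N) → ℝ}
    (hf : ContDiff ℝ n f) (hmn : m + 1 ≤ n) (i : Fin N) : ContDiff ℝ m (partialDeriv i f) :=
  (hf.fderiv_right hmn).clm_apply contDiff_const

lemma contDiff_one_partialDeriv {f : EuclideanSpace ℝ (Fin N) → ℝ} (hf : ContDiff ℝ 2 f)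
    (i : Fin N) : ContDiff ℝ 1 (partialDeriv i f) :=
  contDiff_partialDeriv hf (by norm_num) i

lemma continuous_partialDeriv {f : EuclideanSpace ℝ (Fin N) → ℝ} (hf : ContDiff ℝ 1 f)
    (i : Fin N) : Continuous (partialDeriv i f) :=
  (contDiff_partialDeriv (m := 0) hf (by norm_num) i).continuous

lemma continuous_lap {f : EuclideanSpace ℝ (Fin N) → ℝ} (hf : ContDiff ℝ 2 f) :
    Continuous (lap f) :=
  continuous_finsetSum _ fun i _ => continuous_partialDeriv (contDiff_one_partialDeriv hf i) i

lemma hasCompactSupport_partialDeriv {f : EuclideanSpace ℝ (Fin N) → ℝ}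
    (hf : HasCompactSupport f) (i : Fin N) : HasCompactSupport (partialDeriv i f) :=
  hf.fderiv_apply ℝ _

lemma lap_sub_const_mul {f g : EuclideanSpace ℝ (Fin N) → ℝ} (hf : ContDiff ℝ 2 f)
    (hg : ContDiff ℝ 2 g) (c : ℝ) (x : EuclideanSpace ℝ (Fin N)) :
    lap (fun y => f y - c * g y) x = lap f x - c * lap g x := by
  have key : ∀ {f g : EuclideanSpace ℝ (Fin N) → ℝ}, ContDiff ℝ 1 f → ContDiff ℝ 1 g →
      ∀ i, partialDeriv i (fun y => f y - c * g y) =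
        fun y => partialDeriv i f y - c * partialDeriv i g y := by
    intro f g hf hg i
    funext y
    have hf' := (hf.differentiable one_ne_zero y).hasFDerivAt
    have hg' := (hg.differentiable one_ne_zero y).hasFDerivAt
    simp [partialDeriv, (hf'.fun_sub (hg'.const_mul c)).fderiv]
  simp only [lap_eq_sum_partialDeriv, Finset.mul_sum, ← Finset.sum_sub_distrib]
  refine Finset.sum_congr rfl fun i _ => ?_
  rw [key (hf.of_le (by norm_num)) (hg.of_le (by norm_num)) i,
    key (contDiff_one_partialDeriv hf i) (contDiff_one_partialDeriv hg i) i]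

lemma lap_congr_of_eventuallyEq {f g : EuclideanSpace ℝ (Fin N) → ℝ}
    {x : EuclideanSpace ℝ (Fin N)} (h : f =ᶠ[nhds x] g) : lap f x = lap g x := by
  refine Finset.sum_congr rfl fun i _ => ?_
  have : (fun y => fderiv ℝ f y (EuclideanSpace.single i 1)) =ᶠ[nhds x]
      fun y => fderiv ℝ g y (EuclideanSpace.single i 1) := by
    filter_upwards [h.fderiv (𝕜 := ℝ)] with y hy
    rw [hy]
  rw [this.fderiv_eq]

lemma deriv_deriv_nonneg_of_isLocalMin {f : ℝ → ℝ} {x : ℝ} (h : IsLocalMin f x)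
    (hc : ContinuousAt f x) : 0 ≤ deriv (deriv f) x := by
  by_contra! hneg
  have hmax := isLocalMax_of_deriv_deriv_neg hneg h.deriv_eq_zero hc
  have hconst : f =ᶠ[nhds x] fun _ => f x := by
    filter_upwards [h, hmax] with y h1 h2 using le_antisymm h2 h1
  have := hconst.deriv.deriv_eq
  simp at this
  linarith

lemma deriv_comp_add_smul_single {f : EuclideanSpace ℝ (Fin N) → ℝ} (hf : ContDiff ℝ 1 f)
    (x : EuclideanSpace ℝ (Fin N)) (i : Fin N) :
    deriv (fun t : ℝ => f (x + t • EuclideanSpace.single i 1)) =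
      fun t => partialDeriv i f (x + t • EuclideanSpace.single i 1) := by
  funext t
  have h1 : HasDerivAt (fun t : ℝ => x + t • (EuclideanSpace.single i 1 : EuclideanSpace ℝ (Fin N)))
      (EuclideanSpace.single i 1) t := by
    simpa using ((hasDerivAt_id t).smul_const
      (EuclideanSpace.single i 1 : EuclideanSpace ℝ (Fin N))).const_add x
  exact ((hf.differentiable one_ne_zero _).hasFDerivAt.comp_hasDerivAt t h1).deriv

lemma lap_nonneg_of_isLocalMin {f : EuclideanSpace ℝ (Fin N) → ℝ} (hf : ContDiff ℝ 2 f)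
    {x : EuclideanSpace ℝ (Fin N)} (h : IsLocalMin f x) : 0 ≤ lap f x := by
  rw [lap_eq_sum_partialDeriv]
  refine Finset.sum_nonneg fun i _ => ?_
  set L : ℝ → EuclideanSpace ℝ (Fin N) := fun t => x + t • EuclideanSpace.single i 1 with hL
  have hL0 : L 0 = x := by simp [hL]
  have hLc : Continuous L := by fun_prop
  have h1 : IsLocalMin (f ∘ L) 0 := by
    have : Filter.Tendsto L (nhds 0) (nhds x) := hL0 ▸ hLc.tendsto 0
    have := this.eventually h
    simpa [IsLocalMin, IsMinFilter, hL0] using this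
  have h2 := deriv_deriv_nonneg_of_isLocalMin h1 (hf.continuous.comp hLc).continuousAt
  have e1 : deriv (f ∘ L) = partialDeriv i f ∘ L :=
    deriv_comp_add_smul_single (hf.of_le (by norm_num)) x i
  have e2 : deriv (partialDeriv i f ∘ L) = partialDeriv i (partialDeriv i f) ∘ L :=
    deriv_comp_add_smul_single (contDiff_one_partialDeriv hf i) x i
  rw [e1, e2] at h2
  simpa [hL0] using h2

/-- Minimum principle: a `C²` function whose Laplacian is negative wherever the function is
negative, and which is negative only in the interior of a compact set, is nonnegative there. -/
lemma nonneg_of_lap_neg {f : EuclideanSpace ℝ (Fin N) → ℝ} (hf : ContDiff ℝ 2 f)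
    {S : Set (EuclideanSpace ℝ (Fin N))} (hS : IsCompact S)
    (h : ∀ x ∈ S, f x < 0 → S ∈ nhds x ∧ lap f x < 0) : ∀ x ∈ S, 0 ≤ f x := by
  intro y hy
  obtain ⟨x, hx, hmin⟩ := hS.exists_isMinOn ⟨y, hy⟩ hf.continuous.continuousOn
  by_contra! hneg
  obtain ⟨h1, h2⟩ := h x hx ((hmin hy).trans_lt hneg)
  exact h2.not_ge (lap_nonneg_of_isLocalMin hf (hmin.isLocalMin h1))

lemma integral_mul_partialDeriv {f g : EuclideanSpace ℝ (Fin N) → ℝ} (hf : ContDiff ℝ 1 f)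
    (hg : ContDiff ℝ 1 g) (hc : HasCompactSupport f) (i : Fin N) :
    ∫ x, f x * partialDeriv i g x = -∫ x, partialDeriv i f x * g x := by
  have hf' := continuous_partialDeriv hf i
  have hg' := continuous_partialDeriv hg i
  refine integral_mul_fderiv_eq_neg_fderiv_mul_of_integrable ?_ ?_ ?_
    (fun x _ => hf.differentiable one_ne_zero x) (fun x _ => hg.differentiable one_ne_zero x)
  · exact (hf'.mul hg.continuous).integrable_of_hasCompactSupport
      (hasCompactSupport_partialDeriv hc i).mul_right
  · exact (hf.continuous.mul hg').integrable_of_hasCompactSupport hc.mul_right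
  · exact (hf.continuous.mul hg.continuous).integrable_of_hasCompactSupport hc.mul_right

lemma integral_mul_lap {f g : EuclideanSpace ℝ (Fin N) → ℝ} (hf : ContDiff ℝ 2 f)
    (hg : ContDiff ℝ 2 g) (hc : HasCompactSupport f) :
    ∫ x, f x * lap g x = ∫ x, lap f x * g x := by
  have h1 := fun i => contDiff_one_partialDeriv hf i
  have h2 := fun i => contDiff_one_partialDeriv hg i
  have hc' := fun i => hasCompactSupport_partialDeriv hc i
  simp only [lap_eq_sum_partialDeriv, Finset.mul_sum, Finset.sum_mul]
  rw [integral_finsetSum, integral_finsetSum]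
  · refine Finset.sum_congr rfl fun i _ => ?_
    rw [integral_mul_partialDeriv (hf.of_le (by norm_num)) (h2 i) hc,
      integral_mul_partialDeriv (h1 i) (hg.of_le (by norm_num)) (hc' i), neg_neg]
  · exact fun i _ => ((continuous_partialDeriv (h1 i) i).mul
      hg.continuous).integrable_of_hasCompactSupport
      (hasCompactSupport_partialDeriv (hc' i) i).mul_right
  · exact fun i _ => (hf.continuous.mul
      (continuous_partialDeriv (h2 i) i)).integrable_of_hasCompactSupport hc.mul_right

end Analysis

section MeanValue

variable {N : ℕ}

/-- The radial weight `(1 - ‖z‖²)₊²` of the mean value inequality. -/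
noncomputable def radialWeight (z : EuclideanSpace ℝ (Fin N)) : ℝ := max (1 - ‖z‖ ^ 2) 0 ^ 2

/-- A potential of the radial weight: its gradient at `z` is `-(radialWeight z) z`. -/
noncomputable def radialPotential (z : EuclideanSpace ℝ (Fin N)) : ℝ := max (1 - ‖z‖ ^ 2) 0 ^ 3 / 6

lemma continuous_radialWeight : Continuous (radialWeight (N := N)) := by
  unfold radialWeight; fun_prop

lemma radialWeight_nonneg (z : EuclideanSpace ℝ (Fin N)) : 0 ≤ radialWeight z := sq_nonneg _

lemma radialPotential_nonneg (z : EuclideanSpace ℝ (Fin N)) : 0 ≤ radialPotential z := by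
  unfold radialPotential; positivity

lemma radialPotential_le (z : EuclideanSpace ℝ (Fin N)) : radialPotential z ≤ radialWeight z := by
  have h0 : 0 ≤ max (1 - ‖z‖ ^ 2) 0 := le_max_right _ _
  have h1 : max (1 - ‖z‖ ^ 2) 0 ≤ 1 := max_le (by nlinarith [sq_nonneg ‖z‖]) zero_le_one
  unfold radialPotential radialWeight
  nlinarith [mul_nonneg (sq_nonneg (max (1 - ‖z‖ ^ 2) 0)) (sub_nonneg.2 h1),
    sq_nonneg (max (1 - ‖z‖ ^ 2) 0)]

lemma max_one_sub_norm_sq_eq_zero {z : EuclideanSpace ℝ (Fin N)} (hz : 1 ≤ ‖z‖) :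
    max (1 - ‖z‖ ^ 2) 0 = 0 := max_eq_right (by nlinarith)

lemma radialWeight_eq_zero {z : EuclideanSpace ℝ (Fin N)} (hz : 1 ≤ ‖z‖) : radialWeight z = 0 := by
  simp [radialWeight, max_one_sub_norm_sq_eq_zero hz]

lemma radialPotential_eq_zero {z : EuclideanSpace ℝ (Fin N)} (hz : 1 ≤ ‖z‖) :
    radialPotential z = 0 := by
  simp [radialPotential, max_one_sub_norm_sq_eq_zero hz]

lemma hasCompactSupport_of_eq_zero_of_one_le {f : EuclideanSpace ℝ (Fin N) → ℝ}
    (h : ∀ z, 1 ≤ ‖z‖ → f z = 0) : HasCompactSupport f :=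
  HasCompactSupport.intro (isCompact_closedBall 0 1) fun z hz =>
    h z (by simpa using (not_le.1 (by simpa using hz)).le)

lemma hasCompactSupport_radialWeight : HasCompactSupport (radialWeight (N := N)) :=
  hasCompactSupport_of_eq_zero_of_one_le fun _ => radialWeight_eq_zero

lemma hasCompactSupport_radialPotential : HasCompactSupport (radialPotential (N := N)) :=
  hasCompactSupport_of_eq_zero_of_one_le fun _ => radialPotential_eq_zero

lemma hasFDerivAt_radialPotential (z : EuclideanSpace ℝ (Fin N)) :
    HasFDerivAt radialPotential (-(radialWeight z) • innerSL ℝ z) z := by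
  have h1 : HasFDerivAt (fun z : EuclideanSpace ℝ (Fin N) => 1 - ‖z‖ ^ 2)
      (-(2 • innerSL ℝ z)) z := (hasStrictFDerivAt_norm_sq z).hasFDerivAt.const_sub 1
  have h2 := (HasDerivAt.comp_hasFDerivAt (h₂ := fun y : ℝ => max y 0 ^ 3) z
    (hasDerivAt_max_zero_pow 1 (1 - ‖z‖ ^ 2)) h1).const_mul (1 / 6 : ℝ)
  convert! h2 using 1
  · funext y; simp only [radialPotential, Function.comp]; ring
  · ext v
    simp [radialWeight]; ring

lemma contDiff_radialPotential : ContDiff ℝ 1 (radialPotential (N := N)) := by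
  rw [contDiff_one_iff_fderiv]
  refine ⟨fun z => (hasFDerivAt_radialPotential z).differentiableAt, ?_⟩
  rw [funext fun z => (hasFDerivAt_radialPotential (N := N) z).fderiv]
  exact continuous_radialWeight.neg.smul (innerSL ℝ).continuous

lemma partialDeriv_radialPotential (i : Fin N) (z : EuclideanSpace ℝ (Fin N)) :
    partialDeriv i radialPotential z = -(radialWeight z * z i) := by
  simp [partialDeriv, (hasFDerivAt_radialPotential z).fderiv, EuclideanSpace.inner_single_right]

lemma fderiv_apply_eq_sum (f : EuclideanSpace ℝ (Fin N) → ℝ) (p z : EuclideanSpace ℝ (Fin N)) :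
    fderiv ℝ f p z = ∑ i, z i * partialDeriv i f p := by
  conv_lhs => rw [← (EuclideanSpace.basisFun (Fin N) ℝ).sum_repr z]
  simp [partialDeriv]

lemma partialDeriv_comp_add_smul {f : EuclideanSpace ℝ (Fin N) → ℝ} (hf : ContDiff ℝ 1 f)
    (x : EuclideanSpace ℝ (Fin N)) (r : ℝ) (i : Fin N) (z : EuclideanSpace ℝ (Fin N)) :
    partialDeriv i (fun z => f (x + r • z)) z = r * partialDeriv i f (x + r • z) := by
  have h1 : HasFDerivAt (fun z : EuclideanSpace ℝ (Fin N) => x + r • z)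
      (r • ContinuousLinearMap.id ℝ _) z := ((hasFDerivAt_id z).const_smul r).const_add x
  have h2 := (hf.differentiable one_ne_zero (x + r • z)).hasFDerivAt.comp z h1
  have h3 : fderiv ℝ (fun z => f (x + r • z)) z = _ := h2.fderiv
  simp [partialDeriv, h3]

lemma integral_radialWeight_mul_fderiv {U : EuclideanSpace ℝ (Fin N) → ℝ} (hU : ContDiff ℝ 2 U)
    (x : EuclideanSpace ℝ (Fin N)) (r : ℝ) :
    ∫ z, radialWeight z * fderiv ℝ U (x + r • z) z =
      r * ∫ z, radialPotential z * lap U (x + r • z) := by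
  have haff : ContDiff ℝ 1 fun z : EuclideanSpace ℝ (Fin N) => x + r • z := by fun_prop
  have hD : ∀ i, ContDiff ℝ 1 fun z => partialDeriv i U (x + r • z) :=
    fun i => (contDiff_one_partialDeriv hU i).comp haff
  have hw := continuous_radialWeight (N := N)
  have step : ∀ i, ∫ z, radialWeight z * (z i * partialDeriv i U (x + r • z)) =
      r * ∫ z, radialPotential z * partialDeriv i (partialDeriv i U) (x + r • z) := by
    intro i
    have := integral_mul_partialDeriv contDiff_radialPotential (hD i)
      hasCompactSupport_radialPotential i
    simp only [partialDeriv_comp_add_smul (contDiff_one_partialDeriv hU i),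
      partialDeriv_radialPotential, neg_mul, integral_neg, neg_neg] at this
    rw [← integral_const_mul]
    calc _ = ∫ z, radialWeight z * z i * partialDeriv i U (x + r • z) := by
          simp only [mul_assoc]
      _ = _ := this.symm
      _ = _ := by congr 1; funext z; ring
  simp only [fderiv_apply_eq_sum, lap_eq_sum_partialDeriv, Finset.mul_sum]
  rw [integral_finsetSum, integral_finsetSum, Finset.mul_sum]
  · exact Finset.sum_congr rfl fun i _ => step i
  · exact fun i _ => (contDiff_radialPotential.continuous.mul
      ((continuous_partialDeriv (contDiff_one_partialDeriv hU i) i).comp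
        haff.continuous)).integrable_of_hasCompactSupport
          hasCompactSupport_radialPotential.mul_right
  · refine fun i _ => (hw.mul (Continuous.mul (by fun_prop)
      (hD i).continuous)).integrable_of_hasCompactSupport hasCompactSupport_radialWeight.mul_right

lemma hasDerivAt_integral_radialWeight_mul {U : EuclideanSpace ℝ (Fin N) → ℝ}
    (hU : ContDiff ℝ 1 U) (hc : HasCompactSupport U) (x : EuclideanSpace ℝ (Fin N)) (r : ℝ) :
    HasDerivAt (fun r : ℝ => ∫ z, radialWeight z * U (x + r • z))
      (∫ z, radialWeight z * fderiv ℝ U (x + r • z) z) r := by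
  obtain ⟨M, hM⟩ := (hc.fderiv ℝ).exists_bound_of_continuous (hU.continuous_fderiv one_ne_zero)
  have hU' := hU.continuous_fderiv one_ne_zero
  have hw := continuous_radialWeight (N := N)
  refine (hasDerivAt_integral_of_dominated_loc_of_deriv_le (s := univ)
    (F' := fun r z => radialWeight z * fderiv ℝ U (x + r • z) z)
    (bound := fun z => radialWeight z * M) Filter.univ_mem ?_ ?_ ?_ ?_ ?_ ?_).2
  · refine Filter.Eventually.of_forall fun r => Continuous.aestronglyMeasurable ?_
    exact hw.mul (hU.continuous.comp (by fun_prop))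
  · exact (hw.mul (hU.continuous.comp (by fun_prop))).integrable_of_hasCompactSupport
      hasCompactSupport_radialWeight.mul_right
  · exact (hw.mul ((hU'.comp (by fun_prop)).clm_apply continuous_id)).aestronglyMeasurable
  · refine Filter.Eventually.of_forall fun z r _ => ?_
    rw [norm_mul, Real.norm_of_nonneg (radialWeight_nonneg z)]
    rcases le_total 1 ‖z‖ with hz | hz
    · simp [radialWeight_eq_zero hz]
    · refine mul_le_mul_of_nonneg_left ?_ (radialWeight_nonneg z)
      calc _ ≤ ‖fderiv ℝ U (x + r • z)‖ * ‖z‖ := ContinuousLinearMap.le_opNorm _ _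
        _ ≤ ‖fderiv ℝ U (x + r • z)‖ * 1 := by gcongr
        _ ≤ M := by rw [mul_one]; exact hM _
  · exact (hw.mul continuous_const).integrable_of_hasCompactSupport
      hasCompactSupport_radialWeight.mul_right
  · refine Filter.Eventually.of_forall fun z r _ => ?_
    have h1 : HasDerivAt (fun r : ℝ => x + r • z) z r := by
      simpa using ((hasDerivAt_id r).smul_const z).const_add x
    exact ((hU.differentiable one_ne_zero _).hasFDerivAt.comp_hasDerivAt r h1).const_mul _

/-- Mean value inequality for nonnegative supersolutions of `-Δ U + a U = 0`. -/
lemma integral_radialWeight_mul_le {U : EuclideanSpace ℝ (Fin N) → ℝ} {a : ℝ} (ha : 0 ≤ a)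
    (hU : ContDiff ℝ 2 U) (hc : HasCompactSupport U) (hpos : ∀ y, 0 ≤ U y)
    (x : EuclideanSpace ℝ (Fin N)) (hlap : ∀ y, ‖y - x‖ ≤ 1 → lap U y ≤ a * U y) :
    ∫ y, radialWeight (y - x) * U y ≤
      Real.exp a * (∫ z : EuclideanSpace ℝ (Fin N), radialWeight z) * U x := by
  set G : ℝ → ℝ := fun r => ∫ z, radialWeight z * U (x + r • z) with hG
  have hder := hasDerivAt_integral_radialWeight_mul (hU.of_le (by norm_num)) hc x
  have hw := continuous_radialWeight (N := N)
  have hle : ∀ r ∈ Ioo (0 : ℝ) 1, ∫ z, radialWeight z * fderiv ℝ U (x + r • z) z ≤ a * G r := by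
    intro r hr
    have hG0 : 0 ≤ G r := integral_nonneg fun z => mul_nonneg (radialWeight_nonneg z) (hpos _)
    rw [integral_radialWeight_mul_fderiv hU]
    have h1 : ∫ z, radialPotential z * lap U (x + r • z) ≤ a * G r := by
      rw [hG, ← integral_const_mul]
      refine integral_mono ?_ ?_ fun z => ?_
      · exact (contDiff_radialPotential.continuous.mul ((continuous_lap hU).comp
          (by fun_prop))).integrable_of_hasCompactSupport
          hasCompactSupport_radialPotential.mul_right
      · exact ((hw.mul (hU.continuous.comp (by fun_prop))).integrable_of_hasCompactSupport
          hasCompactSupport_radialWeight.mul_right).const_mul a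
      · change radialPotential z * lap U (x + r • z) ≤ a * (radialWeight z * U (x + r • z))
        rcases le_total 1 ‖z‖ with hz | hz
        · simp [radialWeight_eq_zero hz, radialPotential_eq_zero hz]
        · have h2 : lap U (x + r • z) ≤ a * U (x + r • z) := by
            apply hlap
            rw [add_sub_cancel_left, norm_smul, Real.norm_of_nonneg hr.1.le]
            nlinarith [hr.1, hr.2, norm_nonneg z]
          calc _ ≤ radialPotential z * (a * U (x + r • z)) :=
                mul_le_mul_of_nonneg_left h2 (radialPotential_nonneg z)
            _ ≤ radialWeight z * (a * U (x + r • z)) :=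
                mul_le_mul_of_nonneg_right (radialPotential_le z) (mul_nonneg ha (hpos _))
            _ = _ := by ring
    calc _ ≤ r * (a * G r) := mul_le_mul_of_nonneg_left h1 hr.1.le
      _ ≤ 1 * (a * G r) := mul_le_mul_of_nonneg_right hr.2.le (mul_nonneg ha hG0)
      _ = _ := one_mul _
  have hE : ∀ r, HasDerivAt (fun r => Real.exp (-a * r) * G r)
      (Real.exp (-a * r) * (-a) * G r +
        Real.exp (-a * r) * ∫ z, radialWeight z * fderiv ℝ U (x + r • z) z) r := fun r =>
    (((hasDerivAt_id r).const_mul (-a)).exp.congr_deriv (by simp)).mul (hder r)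
  have hanti : AntitoneOn (fun r => Real.exp (-a * r) * G r) (Icc 0 1) := by
    refine antitoneOn_of_deriv_nonpos (convex_Icc 0 1)
      (fun r _ => (hE r).continuousAt.continuousWithinAt)
      (fun r _ => (hE r).differentiableAt.differentiableWithinAt) fun r hr => ?_
    rw [interior_Icc] at hr
    rw [(hE r).deriv]
    have := mul_le_mul_of_nonneg_left (hle r hr) (Real.exp_nonneg (-a * r))
    linarith
  have h01 := hanti (left_mem_Icc.2 zero_le_one) (right_mem_Icc.2 zero_le_one) zero_le_one
  have hG0 : G 0 = (∫ z : EuclideanSpace ℝ (Fin N), radialWeight z) * U x := by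
    simp [hG, integral_mul_const]
  have hG1 : G 1 = ∫ y, radialWeight (y - x) * U y := by
    rw [← integral_add_left_eq_self (fun y => radialWeight (y - x) * U y) x]
    simp [hG]
  simp only [mul_one, mul_zero, Real.exp_zero, one_mul] at h01
  rw [← hG1, mul_assoc, ← hG0]
  calc G 1 = Real.exp a * (Real.exp (-a) * G 1) := by
        rw [← mul_assoc, ← Real.exp_add]; simp
    _ ≤ _ := mul_le_mul_of_nonneg_left h01 (Real.exp_nonneg a)

end MeanValue

section Interior

variable {N : ℕ}

/-- The closed cube of center `z` and half side `τ`. -/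
def closedCube (τ : ℝ) (z : EuclideanSpace ℝ (Fin N)) : Set (EuclideanSpace ℝ (Fin N)) :=
  {x | ∀ i, |x i - z i| ≤ τ}

lemma isClosed_closedCube (τ : ℝ) (z : EuclideanSpace ℝ (Fin N)) : IsClosed (closedCube τ z) := by
  simp only [closedCube, ofPred_forall]
  exact isClosed_iInter fun i => isClosed_le (by fun_prop) continuous_const

lemma norm_sub_le_of_forall_abs_le {x y : EuclideanSpace ℝ (Fin N)} {d : ℝ}
    (h : ∀ i, |x i - y i| ≤ d) : ‖x - y‖ ^ 2 ≤ N * d ^ 2 := by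
  rw [EuclideanSpace.norm_sq_eq]
  calc _ ≤ ∑ _i : Fin N, d ^ 2 := by
        refine Finset.sum_le_sum fun i _ => ?_
        rw [Real.norm_eq_abs]
        exact pow_le_pow_left₀ (abs_nonneg _) (h i) 2
    _ = _ := by simp

lemma isCompact_closedCube (τ : ℝ) (z : EuclideanSpace ℝ (Fin N)) :
    IsCompact (closedCube τ z) := by
  refine isCompact_of_isClosed_isBounded (isClosed_closedCube τ z) ?_
  refine (isBounded_closedBall (x := z) (r := √(N * τ ^ 2))).subset fun x hx => ?_
  rw [mem_closedBall, dist_eq_norm]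
  exact Real.le_sqrt_of_sq_le (norm_sub_le_of_forall_abs_le hx)

lemma isOpen_cube (ρ : ℝ) (z : EuclideanSpace ℝ (Fin N)) : IsOpen (cube ρ z) := by
  simp only [cube, ofPred_forall]
  exact isOpen_iInter_of_finite fun i => isOpen_lt (by fun_prop) continuous_const

lemma closedCube_mem_nhds {τ : ℝ} {x z : EuclideanSpace ℝ (Fin N)} (h : ∀ i, |x i - z i| < τ) :
    closedCube τ z ∈ nhds x := by
  have hx : x ∈ cube (2 * τ) z := fun i => by rw [mul_div_cancel_left₀ _ two_ne_zero]; exact h i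
  refine Filter.mem_of_superset ((isOpen_cube _ z).mem_nhds hx) fun y hy i => ?_
  have := hy i
  rw [mul_div_cancel_left₀ _ two_ne_zero] at this
  exact this.le

/-- The barrier on the cube of half side `τ` centered at `z`. -/
noncomputable def cubeBarrier (α τ : ℝ) (z x : EuclideanSpace ℝ (Fin N)) : ℝ :=
  ∏ i, barrier α τ (x i - z i)

/-- The test function on the cube of half side `τ` centered at `z`. -/
noncomputable def cubeTest (α τ : ℝ) (z x : EuclideanSpace ℝ (Fin N)) : ℝ :=
  ∏ i, testBump α τ (x i - z i)

lemma contDiff_cubeBarrier (α τ : ℝ) (z : EuclideanSpace ℝ (Fin N)) :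
    ContDiff ℝ 2 (cubeBarrier α τ z) :=
  contDiff_prod_coord fun _ => (contDiff_barrier α τ).comp (contDiff_id.sub contDiff_const)

lemma contDiff_cubeTest (α τ : ℝ) (z : EuclideanSpace ℝ (Fin N)) :
    ContDiff ℝ 2 (cubeTest α τ z) :=
  contDiff_prod_coord fun _ => (contDiff_testBump α τ).comp (contDiff_id.sub contDiff_const)

lemma cubeTest_nonneg (α τ : ℝ) (z x : EuclideanSpace ℝ (Fin N)) : 0 ≤ cubeTest α τ z x :=
  Finset.prod_nonneg fun _ _ => testBump_nonneg

lemma cubeTest_le {α τ : ℝ} (hα : 0 ≤ α) (h0 : 0 ≤ τ) (h2 : τ ≤ 2)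
    (z x : EuclideanSpace ℝ (Fin N)) : cubeTest α τ z x ≤ 64 ^ N := by
  simpa [cubeTest] using Finset.prod_le_prod (s := Finset.univ) (g := fun _ : Fin N => (64 : ℝ))
    (f := fun i => testBump α τ (x i - z i))
    (fun _ _ => testBump_nonneg) fun _ _ => testBump_le hα h0 h2

lemma cubeTest_eq_zero {α τ : ℝ} (h0 : 0 ≤ τ) {z x : EuclideanSpace ℝ (Fin N)}
    (hx : x ∉ closedCube τ z) : cubeTest α τ z x = 0 := by
  simp only [closedCube, mem_ofPred_eq, not_forall, not_le] at hx
  obtain ⟨i, hi⟩ := hx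
  exact Finset.prod_eq_zero (Finset.mem_univ i) (testBump_eq_zero h0 hi.le)

lemma cubeBarrier_nonneg {α τ : ℝ} {z x : EuclideanSpace ℝ (Fin N)} (hx : x ∈ closedCube τ z) :
    0 ≤ cubeBarrier α τ z x :=
  Finset.prod_nonneg fun i _ => barrier_nonneg (hx i)

lemma cubeBarrier_le {α τ : ℝ} (hα : 0 ≤ α) (h2 : τ ≤ 2) {z x : EuclideanSpace ℝ (Fin N)}
    (hx : x ∈ closedCube τ z) : cubeBarrier α τ z x ≤ 4 ^ N := by
  simpa [cubeBarrier] using Finset.prod_le_prod (s := Finset.univ) (g := fun _ : Fin N => (4 : ℝ))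
    (fun i _ => barrier_nonneg (hx i)) fun i _ => barrier_le hα (hx i) h2

lemma cubeBarrier_eq_zero {α τ : ℝ} {z x : EuclideanSpace ℝ (Fin N)} {i : Fin N}
    (hi : |x i - z i| = τ) : cubeBarrier α τ z x = 0 := by
  refine Finset.prod_eq_zero (Finset.mem_univ i) ?_
  simp [barrier, ← hi]

variable {α r τ : ℝ} {z x : EuclideanSpace ℝ (Fin N)}

lemma lap_cubeBarrier_ge (hα : 0 ≤ α) (hαr : 1 ≤ 4 * α * r ^ 2) (hr : 0 ≤ r) (hr1 : r ≤ 1)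
    (hτ : 3 / 2 ≤ τ) (hK : 0 ≤ 4 * α ^ 2 * r ^ 2 - 2 * α) (hx : x ∈ closedCube τ z)
    (hx' : x ∉ closedCube r z) :
    (4 * α ^ 2 * r ^ 2 - 2 * α - N * (6 + 2 * α)) * cubeBarrier α τ z x ≤
      lap (cubeBarrier α τ z) x := by
  simp only [closedCube, mem_ofPred_eq, not_forall, not_le] at hx'
  have h1 := sum_ite_exists_ge hK (by linarith : 0 ≤ 6 + 2 * α) hx'
  refine (mul_le_mul_of_nonneg_right h1 (cubeBarrier_nonneg hx)).trans ?_
  refine lap_prod_coord_ge (g := fun i t => barrier α τ (t - z i))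
    (fun i t => (hasDerivAt_barrier α τ (t - z i)).comp_sub_const t (z i))
    (fun i t => (hasDerivAt_barrierDeriv α τ (t - z i)).comp_sub_const t (z i))
    (fun i => barrier_nonneg (hx i)) fun i => ?_
  split_ifs with h
  · exact barrierDeriv2_ge_of_le hα hαr hr h.le (hx i)
  · exact barrierDeriv2_ge hα hαr hr hr1 hτ (hx i)

lemma lap_cubeTest_ge_neg (hα : 0 ≤ α) (hαr : 1 ≤ 4 * α * r ^ 2) (hr : 0 ≤ r) (hr1 : r ≤ 1)
    (hτ : 3 / 2 ≤ τ) :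
    -(N * (6 + 2 * α)) * cubeTest α τ z x ≤ lap (cubeTest α τ z) x := by
  have := lap_prod_coord_ge (g := fun i t => testBump α τ (t - z i)) (x := x)
    (fun i t => (hasDerivAt_testBump α τ (t - z i)).comp_sub_const t (z i))
    (fun i t => (hasDerivAt_testBumpDeriv α τ (t - z i)).comp_sub_const t (z i))
    (fun i => testBump_nonneg) (k := fun _ => -(6 + 2 * α))
    fun i => testBumpDeriv2_ge hα hαr hr hr1 hτ
  rwa [Finset.sum_const, Finset.card_univ, Fintype.card_fin, nsmul_eq_mul, mul_neg] at this

lemma lap_cubeTest_ge (hα : 0 ≤ α) (hαr : 1 ≤ 4 * α * r ^ 2) (hr : 0 ≤ r) (hr1 : r ≤ 1)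
    (hτ : 3 / 2 ≤ τ) (hK : 0 ≤ 4 * α ^ 2 * r ^ 2 - 2 * α) (hx' : x ∉ closedCube r z) :
    (4 * α ^ 2 * r ^ 2 - 2 * α - N * (6 + 2 * α)) * cubeTest α τ z x ≤
      lap (cubeTest α τ z) x := by
  simp only [closedCube, mem_ofPred_eq, not_forall, not_le] at hx'
  have h1 := sum_ite_exists_ge hK (by linarith : 0 ≤ 6 + 2 * α) hx'
  refine (mul_le_mul_of_nonneg_right h1 (cubeTest_nonneg α τ z x)).trans ?_
  refine lap_prod_coord_ge (g := fun i t => testBump α τ (t - z i))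
    (fun i t => (hasDerivAt_testBump α τ (t - z i)).comp_sub_const t (z i))
    (fun i t => (hasDerivAt_testBumpDeriv α τ (t - z i)).comp_sub_const t (z i))
    (fun i => testBump_nonneg) fun i => ?_
  split_ifs with h
  · exact testBumpDeriv2_ge_of_le hα hαr hr h.le
  · exact testBumpDeriv2_ge hα hαr hr hr1 hτ

lemma integral_mul_cubeTest_le {a : ℝ} (hα : 0 ≤ α) (hαr : 1 ≤ 4 * α * r ^ 2) (hr : 0 ≤ r)
    (hr1 : r ≤ 1) (hτ : 3 / 2 ≤ τ) (hτ2 : τ ≤ 2) (ha : 0 ≤ a)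
    (hK : a + 1 ≤ 4 * α ^ 2 * r ^ 2 - 2 * α - N * (6 + 2 * α))
    {U : EuclideanSpace ℝ (Fin N) → ℝ} (hU : ContDiff ℝ 2 U) (hc : HasCompactSupport U)
    (hpos : ∀ y, 0 ≤ U y) (hlap : ∀ y ∈ closedCube τ z, lap U y ≤ a * U y) :
    ∫ y, U y * cubeTest α τ z y ≤
      (N * (6 + 2 * α) + a + 1) * 64 ^ N * ∫ y in closedCube r z, U y := by
  set T := cubeTest α τ z with hT
  set Λ := N * (6 + 2 * α) + a + 1 with hΛ
  have hNα : 0 ≤ N * (6 + 2 * α) := by positivity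
  have hK0 : 0 ≤ 4 * α ^ 2 * r ^ 2 - 2 * α := by linarith
  have hΛ0 : 0 ≤ Λ := by linarith
  have hTc := contDiff_cubeTest α τ z
  have hC := (isClosed_closedCube r z).measurableSet
  have hT0 := cubeTest_nonneg α τ z
  have iUT : Integrable fun y => U y * T y :=
    (hU.continuous.mul hTc.continuous).integrable_of_hasCompactSupport hc.mul_right
  have iUL : Integrable fun y => U y * lap T y :=
    (hU.continuous.mul (continuous_lap hTc)).integrable_of_hasCompactSupport hc.mul_right
  have iLT : Integrable fun y => lap U y * T y := by
    refine ((continuous_lap hU).mul hTc.continuous).integrable_of_hasCompactSupport ?_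
    exact (HasCompactSupport.intro (isCompact_closedCube τ z)
      fun y hy => cubeTest_eq_zero (by linarith) hy).mul_left
  have h1 : ∫ y, U y * lap T y ≤ a * ∫ y, U y * T y := by
    rw [integral_mul_lap hU hTc hc, ← integral_const_mul]
    refine integral_mono iLT (iUT.const_mul a) fun y => ?_
    change lap U y * T y ≤ a * (U y * T y)
    by_cases hy : y ∈ closedCube τ z
    · rw [← mul_assoc]
      exact mul_le_mul_of_nonneg_right (hlap y hy) (hT0 y)
    · simp [hT, cubeTest_eq_zero (by linarith : 0 ≤ τ) hy]
  have h2 : (a + 1) * (∫ y, U y * T y) - Λ * (∫ y in closedCube r z, U y * T y) ≤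
      ∫ y, U y * lap T y := by
    rw [← integral_indicator hC, ← integral_const_mul, ← integral_const_mul, ← integral_sub
      (iUT.const_mul _) ((iUT.indicator hC).const_mul _)]
    refine integral_mono ((iUT.const_mul _).sub ((iUT.indicator hC).const_mul _)) iUL fun y => ?_
    by_cases hy : y ∈ closedCube r z
    · simp only [indicator_of_mem hy]
      have := mul_le_mul_of_nonneg_left
        (lap_cubeTest_ge_neg (z := z) (x := y) hα hαr hr hr1 hτ) (hpos y)
      rw [← hT] at this
      rw [hΛ]; linarith
    · simp only [indicator_of_notMem hy]
      have h3 := lap_cubeTest_ge (z := z) (x := y) hα hαr hr hr1 hτ hK0 hy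
      have h4 := mul_le_mul_of_nonneg_left
        ((mul_le_mul_of_nonneg_right hK (hT0 y)).trans h3) (hpos y)
      rw [← hT] at h4
      linarith
  have h3 : ∫ y in closedCube r z, U y * T y ≤ 64 ^ N * ∫ y in closedCube r z, U y := by
    rw [← integral_const_mul]
    refine setIntegral_mono iUT.integrableOn
      ((hU.continuous.integrable_of_hasCompactSupport hc).const_mul _).integrableOn fun y => ?_
    have := mul_le_mul_of_nonneg_left (cubeTest_le hα (by linarith) hτ2 z y) (hpos y)
    change U y * T y ≤ 64 ^ N * U y
    linarith
  have h4 := mul_le_mul_of_nonneg_left h3 hΛ0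
  rw [mul_assoc]
  linarith

lemma setIntegral_closedCube_le {a : ℝ} (ha : 0 ≤ a) (hr1 : N * (2 * r) ^ 2 ≤ 1 / 4)
    (hr2 : r ≤ 1 / 2) (hτ : 3 / 2 ≤ τ) {U : EuclideanSpace ℝ (Fin N) → ℝ} (hU : ContDiff ℝ 2 U)
    (hc : HasCompactSupport U) (hpos : ∀ y, 0 ≤ U y)
    (hlap : ∀ y ∈ closedCube τ z, lap U y ≤ a * U y) (hx : x ∈ closedCube r z) :
    ∫ y in closedCube r z, U y ≤
      2 * (Real.exp a * ∫ w : EuclideanSpace ℝ (Fin N), radialWeight w) * U x := by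
  have hC := (isClosed_closedCube r z).measurableSet
  have h1 := integral_radialWeight_mul_le ha hU hc hpos x fun y hy => hlap y fun i => by
    have h2 : |y i - x i| ≤ 1 := by
      have := PiLp.norm_apply_le (y - x) i
      rw [Real.norm_eq_abs] at this
      exact this.trans hy
    calc |y i - z i| = |(y i - x i) + (x i - z i)| := by ring_nf
      _ ≤ |y i - x i| + |x i - z i| := abs_add_le _ _
      _ ≤ 1 + r := add_le_add h2 (hx i)
      _ ≤ τ := by linarith
  have h2 : ∫ y in closedCube r z, U y ≤ 2 * ∫ y, radialWeight (y - x) * U y := by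
    rw [← integral_indicator hC, ← integral_const_mul]
    refine integral_mono ((hU.continuous.integrable_of_hasCompactSupport hc).indicator hC) ?_
      fun y => ?_
    · exact (((continuous_radialWeight.comp (by fun_prop)).mul
        hU.continuous).integrable_of_hasCompactSupport hc.mul_left).const_mul 2
    · change (closedCube r z).indicator U y ≤ 2 * (radialWeight (y - x) * U y)
      by_cases hy : y ∈ closedCube r z
      · rw [indicator_of_mem hy]
        have h3 : ‖y - x‖ ^ 2 ≤ N * (2 * r) ^ 2 := norm_sub_le_of_forall_abs_le fun i => by
          calc |y i - x i| = |(y i - z i) - (x i - z i)| := by ring_nf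
            _ ≤ |y i - z i| + |x i - z i| := abs_sub _ _
            _ ≤ 2 * r := by linarith [hy i, hx i]
        have h4 : (3 / 4 : ℝ) ^ 2 ≤ radialWeight (y - x) :=
          pow_le_pow_left₀ (by norm_num) (le_max_of_le_left (by linarith)) 2
        nlinarith [hpos y]
      · rw [indicator_of_notMem hy]
        exact mul_nonneg zero_le_two (mul_nonneg (radialWeight_nonneg _) (hpos y))
  linarith

lemma mul_cubeBarrier_le {a m : ℝ} (hα : 0 ≤ α) (hαr : 1 ≤ 4 * α * r ^ 2) (hr : 0 ≤ r)
    (hr1 : r ≤ 1) (hτ : 3 / 2 ≤ τ) (hτ2 : τ ≤ 2) (ha : 0 ≤ a)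
    (hK : a + 1 ≤ 4 * α ^ 2 * r ^ 2 - 2 * α - N * (6 + 2 * α))
    {U : EuclideanSpace ℝ (Fin N) → ℝ} (hU : ContDiff ℝ 2 U)
    (hpos : ∀ y, 0 ≤ U y) (hlap : ∀ y ∈ closedCube τ z, lap U y ≤ a * U y) (hm : 0 ≤ m)
    (hmU : ∀ y ∈ closedCube r z, m * 4 ^ N ≤ U y) (hx : x ∈ closedCube τ z) :
    m * cubeBarrier α τ z x ≤ U x := by
  have hB := contDiff_cubeBarrier α τ z
  have hNα : 0 ≤ N * (6 + 2 * α) := by positivity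
  refine sub_nonneg.1 (nonneg_of_lap_neg (f := fun y => U y - m * cubeBarrier α τ z y)
    (hU.sub (contDiff_const.mul hB)) (isCompact_closedCube τ z) (fun y hy hneg => ?_) x hx)
  have hBy := cubeBarrier_nonneg (α := α) hy
  refine ⟨closedCube_mem_nhds fun i => (hy i).lt_of_ne fun hi => ?_, ?_⟩
  · rw [cubeBarrier_eq_zero hi] at hneg
    linarith [hpos y]
  · have hy' : y ∉ closedCube r z := fun hy' => by
      have := mul_le_mul_of_nonneg_left (cubeBarrier_le hα hτ2 hy) hm
      linarith [hmU y hy']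
    rw [lap_sub_const_mul hU hB]
    have h1 := lap_cubeBarrier_ge hα hαr hr hr1 hτ (by linarith) hy hy'
    have h2 := mul_le_mul_of_nonneg_left ((mul_le_mul_of_nonneg_right hK hBy).trans h1) hm
    have h3 := mul_nonpos_of_nonneg_of_nonpos ha hneg.le
    linarith [hlap y hy, hpos y]

/-- A nonnegative supersolution dominates the barrier times its own weighted integral. -/
theorem exists_mul_cubeBarrier_mul_integral_le (N : ℕ) {a : ℝ} (ha : 0 ≤ a) :
    ∃ α c : ℝ, 0 ≤ α ∧ 0 < c ∧ ∀ (z : EuclideanSpace ℝ (Fin N)) (τ : ℝ), 3 / 2 ≤ τ → τ ≤ 2 →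
      ∀ U : EuclideanSpace ℝ (Fin N) → ℝ, ContDiff ℝ 2 U → HasCompactSupport U →
        (∀ y, 0 ≤ U y) → (∀ y ∈ closedCube τ z, lap U y ≤ a * U y) →
        ∀ x ∈ closedCube τ z,
          c * cubeBarrier α τ z x * ∫ y, U y * cubeTest α τ z y ≤ U x := by
  set r : ℝ := 1 / (4 * (N + 1)) with hr
  have hr0 : 0 < r := by positivity
  have hrN : r * (4 * (N + 1)) = 1 := by rw [hr]; field_simp
  have hN : (0 : ℝ) ≤ N := N.cast_nonneg
  have hr2 : r ≤ 1 / 4 := by nlinarith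
  have hr1 : N * (2 * r) ^ 2 ≤ 1 / 4 := by nlinarith
  obtain ⟨α, hα, hαr, hK⟩ := exists_barrier_exponent (a + 1) N r hr0
  set D := 2 * (Real.exp a * ∫ w : EuclideanSpace ℝ (Fin N), radialWeight w) with hD
  have hD0 : 0 ≤ D := mul_nonneg zero_le_two
    (mul_nonneg (Real.exp_nonneg a) (integral_nonneg radialWeight_nonneg))
  set Λ := (N * (6 + 2 * α) + a + 1) * 64 ^ N with hΛ
  have hΛ0 : 0 < Λ := by positivity
  refine ⟨α, 1 / ((D + 1) * 4 ^ N * Λ), hα, by positivity,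
    fun z τ hτ hτ2 U hU hc hpos hlap x hx => ?_⟩
  set I := ∫ y in closedCube r z, U y with hI
  have hI0 : 0 ≤ I := integral_nonneg fun y => hpos y
  have h1 := integral_mul_cubeTest_le hα hαr hr0.le (by linarith) hτ hτ2 ha hK hU hc hpos hlap
  have h2 : ∀ y ∈ closedCube r z, I / ((D + 1) * 4 ^ N) * 4 ^ N ≤ U y := fun y hy => by
    have h3 := setIntegral_closedCube_le ha hr1 (by linarith) hτ hU hc hpos hlap hy
    have h4 : I / ((D + 1) * 4 ^ N) * 4 ^ N = I / (D + 1) := by field_simp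
    rw [h4, div_le_iff₀ (by positivity)]
    linarith [hpos y]
  have h3 := mul_cubeBarrier_le hα hαr hr0.le (by linarith) hτ hτ2 ha hK hU hpos hlap
    (by positivity) h2 hx
  refine le_trans ?_ h3
  have hB := cubeBarrier_nonneg (α := α) hx
  calc 1 / ((D + 1) * 4 ^ N * Λ) * cubeBarrier α τ z x * ∫ y, U y * cubeTest α τ z y
      ≤ 1 / ((D + 1) * 4 ^ N * Λ) * cubeBarrier α τ z x * (Λ * I) :=
        mul_le_mul_of_nonneg_left h1 (by positivity)
    _ = _ := by field_simp

end Interior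

section Boundary

open scoped Manifold in
lemma exists_contDiff_eventuallyEq {N : ℕ} {τ ρ : ℝ} {z : EuclideanSpace ℝ (Fin N)} (hτ : τ < ρ / 2)
    {u : EuclideanSpace ℝ (Fin N) → ℝ} (hu : ContDiffOn ℝ 2 u (cube ρ z))
    (hpos : ∀ y ∈ cube ρ z, 0 ≤ u y) :
    ∃ U : EuclideanSpace ℝ (Fin N) → ℝ, ContDiff ℝ 2 U ∧ HasCompactSupport U ∧ (∀ y, 0 ≤ U y) ∧
      ∀ y ∈ closedCube τ z, U =ᶠ[nhds y] u := by
  obtain ⟨σ, hσ, hσ'⟩ := exists_between hτ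
  have hsub : closedCube τ z ⊆ interior (closedCube σ z) := fun y hy =>
    mem_interior_iff_mem_nhds.2 (closedCube_mem_nhds fun i => (hy i).trans_lt hσ)
  obtain ⟨χ, h1, h0, hχ⟩ := exists_contMDiffMap_one_nhds_of_subset_interior (n := 2)
    𝓘(ℝ, EuclideanSpace ℝ (Fin N)) (isClosed_closedCube τ z) hsub
  have hχc : ContDiff ℝ 2 χ := χ.contMDiff.contDiff
  have hz : ∀ y ∉ closedCube σ z, χ y * u y = 0 := fun y hy => by rw [h0 y hy, zero_mul]
  refine ⟨fun y => χ y * u y, contDiff_iff_contDiffAt.2 fun y => ?_,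
    HasCompactSupport.intro (isCompact_closedCube σ z) hz, fun y => ?_, fun y hy => ?_⟩
  · by_cases hy : y ∈ closedCube σ z
    · exact hχc.contDiffAt.mul
        (hu.contDiffAt ((isOpen_cube ρ z).mem_nhds fun i => (hy i).trans_lt hσ'))
    · refine contDiffAt_const (c := (0 : ℝ)) |>.congr_of_eventuallyEq ?_
      filter_upwards [(isClosed_closedCube σ z).isOpen_compl.mem_nhds hy] with w hw
      exact hz w hw
  · by_cases hy : y ∈ closedCube σ z
    · exact mul_nonneg (hχ y).1 (hpos y fun i => (hy i).trans_lt hσ')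
    · exact (hz y hy).ge
  · filter_upwards [(eventually_nhdsSet_iff_forall.1 h1) y hy] with w hw
    rw [hw, one_mul]

variable {α t : ℝ}

lemma exp_neg_mul_sq_ge (hα : 0 ≤ α) (ht : |t| ≤ 2) :
    Real.exp (-(4 * α)) ≤ Real.exp (-α * t ^ 2) := by
  have : t ^ 2 ≤ 2 ^ 2 := by rw [← sq_abs]; exact pow_le_pow_left₀ (abs_nonneg _) ht 2
  exact Real.exp_le_exp.2 (by nlinarith)

lemma mul_exp_le_barrier {τ m : ℝ} (hα : 0 ≤ α) (ht : |t| ≤ 2) (hm0 : 0 ≤ m)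
    (hm : m ≤ τ ^ 2 - t ^ 2) : m * Real.exp (-(4 * α)) ≤ barrier α τ t :=
  mul_le_mul hm (exp_neg_mul_sq_ge hα ht) (Real.exp_nonneg _) (hm0.trans hm)

lemma pow_mul_exp_le_testBump {τ m : ℝ} (hα : 0 ≤ α) (ht : |t| ≤ 2) (hm0 : 0 ≤ m)
    (hm : m ≤ τ ^ 2 - t ^ 2) : m ^ 3 * Real.exp (-(4 * α)) ≤ testBump α τ t :=
  mul_le_mul (pow_le_pow_left₀ hm0 (hm.trans (le_max_left _ _)) 3) (exp_neg_mul_sq_ge hα ht)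
    (Real.exp_nonneg _) (by positivity)

variable {N : ℕ} {n : Fin N} {x : EuclideanSpace ℝ (Fin N)} {d : ℝ}

lemma abs_lt_of_mem_cube_one (hx : x ∈ cube 1 (EuclideanSpace.single n (1 / 2))) {i : Fin N}
    (hi : i ≠ n) : |x i| < 1 / 2 := by
  have := hx i
  simpa [hi] using this

lemma mem_Ioo_of_mem_cube_one (hx : x ∈ cube 1 (EuclideanSpace.single n (1 / 2))) :
    x n ∈ Ioo (0 : ℝ) 1 := by
  have := hx n
  simp only [PiLp.single_apply, if_true, abs_lt] at this
  constructor <;> linarith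

lemma mem_closedCube_of_mem_cube_one (hx : x ∈ cube 1 (EuclideanSpace.single n (1 / 2)))
    (hd : d ≤ 1 / 2) (hxd : d ≤ x n) : x ∈ closedCube (2 - d) (EuclideanSpace.single n 2) := by
  intro i
  by_cases hi : i = n
  · subst hi
    have := mem_Ioo_of_mem_cube_one hx
    simp only [PiLp.single_apply, if_true, abs_le]
    constructor <;> linarith [this.1, this.2]
  · have := abs_lt_of_mem_cube_one hx hi
    simp only [PiLp.single_apply, hi, if_false, sub_zero]
    linarith

lemma mem_cube_four_of_mem_cube_one (hx : x ∈ cube 1 (EuclideanSpace.single n (1 / 2))) :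
    x ∈ cube 4 (EuclideanSpace.single n 2) := fun i => by
  have hn := mem_Ioo_of_mem_cube_one hx
  exact (mem_closedCube_of_mem_cube_one hx (d := x n / 2) (by linarith [hn.2])
    (by linarith [hn.1]) i).trans_lt (by linarith [hn.1])

lemma ite_le_sq_sub_sq (hx : x ∈ cube 1 (EuclideanSpace.single n (1 / 2)))
    (hd : d ≤ 1 / 2) (hxd : 2 * d ≤ x n) (i : Fin N) :
    (if i = n then x n / 2 else 1) ≤
      (2 - d) ^ 2 - (x i - EuclideanSpace.single n (2 : ℝ) i) ^ 2 := by
  have hn := mem_Ioo_of_mem_cube_one hx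
  split_ifs with hi
  · subst hi
    simp only [PiLp.single_apply, if_true]
    nlinarith [hn.1, hn.2]
  · have := abs_lt.1 (abs_lt_of_mem_cube_one hx hi)
    simp only [PiLp.single_apply, hi, if_false, sub_zero]
    nlinarith [this.1, this.2]

lemma mul_exp_le_cubeBarrier (hα : 0 ≤ α) (hx : x ∈ cube 1 (EuclideanSpace.single n (1 / 2)))
    (hd0 : 0 ≤ d) (hd : d ≤ 1 / 2) (hxd : 2 * d ≤ x n) :
    x n / 2 * Real.exp (-(4 * α)) ^ N ≤ cubeBarrier α (2 - d) (EuclideanSpace.single n 2) x := by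
  have hn := mem_Ioo_of_mem_cube_one hx
  have hm : ∀ i : Fin N, 0 ≤ if i = n then x n / 2 else 1 := fun i => by
    split_ifs <;> linarith [hn.1]
  calc _ = ∏ i : Fin N, (if i = n then x n / 2 else 1) * Real.exp (-(4 * α)) := by
        rw [Finset.prod_mul_distrib]; simp
    _ ≤ _ := Finset.prod_le_prod (fun i _ => mul_nonneg (hm i) (Real.exp_nonneg _)) fun i _ =>
        mul_exp_le_barrier hα ((mem_closedCube_of_mem_cube_one hx hd (by linarith) i).trans
          (by linarith)) (hm i) (ite_le_sq_sub_sq hx hd hxd i)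

lemma mul_exp_le_cubeTest (hα : 0 ≤ α) (hx : x ∈ cube 1 (EuclideanSpace.single n (1 / 2)))
    (hd0 : 0 ≤ d) (hd : d ≤ 1 / 2) (hxd : 2 * d ≤ x n) :
    (x n / 2) ^ 3 * Real.exp (-(4 * α)) ^ N ≤
      cubeTest α (2 - d) (EuclideanSpace.single n 2) x := by
  have hn := mem_Ioo_of_mem_cube_one hx
  have hm : ∀ i : Fin N, 0 ≤ if i = n then x n / 2 else 1 := fun i => by
    split_ifs <;> linarith [hn.1]
  calc _ = ∏ i : Fin N, (if i = n then x n / 2 else 1) ^ 3 * Real.exp (-(4 * α)) := by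
        rw [Finset.prod_mul_distrib, Finset.prod_pow]; simp
    _ ≤ _ := Finset.prod_le_prod
        (fun i _ => mul_nonneg (pow_nonneg (hm i) 3) (Real.exp_nonneg _)) fun i _ =>
        pow_mul_exp_le_testBump hα ((mem_closedCube_of_mem_cube_one hx hd (by linarith) i).trans
          (by linarith)) (hm i) (ite_le_sq_sub_sq hx hd hxd i)

/-- The part of the half cube of side `1` at distance more than `h` from the flat boundary. -/
def innerCube (n : Fin N) (h : ℝ) : Set (EuclideanSpace ℝ (Fin N)) :=
  cube 1 (EuclideanSpace.single n (1 / 2)) ∩ {y | h < y n}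

lemma exists_mul_setIntegral_innerCube_le (n : Fin N) {a : ℝ} (ha : 0 ≤ a) :
    ∃ c : ℝ, 0 < c ∧ ∀ u : EuclideanSpace ℝ (Fin N) → ℝ,
      ContDiffOn ℝ 2 u (cube 4 (EuclideanSpace.single n 2)) →
      (∀ y ∈ cube 4 (EuclideanSpace.single n 2), 0 ≤ u y) →
      (∀ y ∈ cube 4 (EuclideanSpace.single n 2), 0 ≤ -lap u y + a * u y) →
      ∀ h, 0 < h → h ≤ 1 →
        IntegrableOn (fun y => u y * y n ^ 3) (innerCube n h) ∧ ∀ x ∈ innerCube n h,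
          c * x n * ∫ y in innerCube n h, u y * y n ^ 3 ≤ u x := by
  obtain ⟨α, c, hα, hc, key⟩ := exists_mul_cubeBarrier_mul_integral_le N ha
  set e := Real.exp (-(4 * α)) ^ N with he
  have he0 : 0 < e := by positivity
  refine ⟨c * (e / 2) * (e / 8), by positivity, fun u hu hpos hlap h hh0 hh1 => ?_⟩
  set z : EuclideanSpace ℝ (Fin N) := EuclideanSpace.single n 2 with hz
  have hsub : closedCube (2 - h / 2) z ⊆ cube 4 z := fun y hy i => (hy i).trans_lt (by linarith)
  obtain ⟨U, hU, hUc, hU0, hUu⟩ :=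
    exists_contDiff_eventuallyEq (τ := 2 - h / 2) (by linarith) hu hpos
  have hmem : ∀ y ∈ innerCube n h, y ∈ closedCube (2 - h / 2) z := fun y hy =>
    mem_closedCube_of_mem_cube_one hy.1 (by linarith) (by linarith [show h < y n from hy.2])
  have hmeas : MeasurableSet (innerCube n h) :=
    ((isOpen_cube _ _).inter (isOpen_lt continuous_const (by fun_prop))).measurableSet
  have hcont : Continuous fun y : EuclideanSpace ℝ (Fin N) => y n ^ 3 := by fun_prop
  have iU : Integrable fun y => U y * y n ^ 3 :=
    (hU.continuous.mul hcont).integrable_of_hasCompactSupport hUc.mul_right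
  have iUT : Integrable fun y => U y * cubeTest α (2 - h / 2) z y :=
    (hU.continuous.mul (contDiff_cubeTest _ _ _).continuous).integrable_of_hasCompactSupport
      hUc.mul_right
  have heq : ∀ y ∈ innerCube n h, U y * y n ^ 3 = u y * y n ^ 3 := fun y hy => by
    rw [(hUu y (hmem y hy)).eq_of_nhds]
  refine ⟨iU.integrableOn.congr_fun heq hmeas, fun x hx => ?_⟩
  have hxU := key z (2 - h / 2) (by linarith) (by linarith) U hU hUc hU0 (fun y hy => by
    rw [lap_congr_of_eventuallyEq (hUu y hy), (hUu y hy).eq_of_nhds]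
    linarith [hlap y (hsub hy)]) x (hmem x hx)
  rw [(hUu x (hmem x hx)).eq_of_nhds] at hxU
  have hB := mul_exp_le_cubeBarrier hα hx.1 (d := h / 2) (by linarith) (by linarith)
    (by linarith [show h < x n from hx.2])
  have hI : e / 8 * ∫ y in innerCube n h, u y * y n ^ 3 ≤
      ∫ y, U y * cubeTest α (2 - h / 2) z y := by
    rw [← setIntegral_congr_fun hmeas heq, ← integral_const_mul, ← integral_indicator hmeas]
    refine integral_mono ((iU.const_mul _).indicator hmeas) iUT fun y => ?_
    refine indicator_apply_le' (fun hy => ?_)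
      (fun _ => mul_nonneg (hU0 y) (cubeTest_nonneg _ _ _ _))
    have hT := mul_exp_le_cubeTest hα hy.1 (d := h / 2) (by linarith) (by linarith)
      (by linarith [show h < y n from hy.2])
    have := mul_le_mul_of_nonneg_left hT (hU0 y)
    rw [← he, ← hz] at this
    calc _ = U y * ((y n / 2) ^ 3 * e) := by ring
      _ ≤ _ := this
  have hxn := (mem_Ioo_of_mem_cube_one hx.1).1
  have hI0 : 0 ≤ ∫ y in innerCube n h, u y * y n ^ 3 := setIntegral_nonneg hmeas fun y hy =>
    mul_nonneg (hpos y (hsub (hmem y hy))) (pow_nonneg (mem_Ioo_of_mem_cube_one hy.1).1.le 3)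
  calc _ = c * (x n / 2 * e) * (e / 8 * ∫ y in innerCube n h, u y * y n ^ 3) := by ring
    _ ≤ c * cubeBarrier α (2 - h / 2) z x * ∫ y, U y * cubeTest α (2 - h / 2) z y :=
        mul_le_mul (mul_le_mul_of_nonneg_left hB hc.le) hI (by positivity)
          (mul_nonneg hc.le (cubeBarrier_nonneg (hmem x hx)))
    _ ≤ u x := hxU

lemma exists_mul_setIntegral_cube_le (n : Fin N) {a : ℝ} (ha : 0 ≤ a) :
    ∃ c : ℝ, 0 < c ∧ ∀ u : EuclideanSpace ℝ (Fin N) → ℝ,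
      ContDiffOn ℝ 2 u (cube 4 (EuclideanSpace.single n 2)) →
      (∀ y ∈ cube 4 (EuclideanSpace.single n 2), 0 ≤ u y) →
      (∀ y ∈ cube 4 (EuclideanSpace.single n 2), 0 ≤ -lap u y + a * u y) →
      ∀ x ∈ cube 1 (EuclideanSpace.single n (1 / 2)),
        IntegrableOn (fun y => u y * y n ^ 3) (cube 1 (EuclideanSpace.single n (1 / 2))) ∧
        c * x n * ∫ y in cube 1 (EuclideanSpace.single n (1 / 2)), u y * y n ^ 3 ≤ u x := by
  obtain ⟨c, hc, key⟩ := exists_mul_setIntegral_innerCube_le n ha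
  refine ⟨c, hc, fun u hu hpos hlap x hx => ?_⟩
  set Q : Set (EuclideanSpace ℝ (Fin N)) := cube 1 (EuclideanSpace.single n (1 / 2)) with hQ
  have hQm : MeasurableSet Q := (isOpen_cube _ _).measurableSet
  have hxn := (mem_Ioo_of_mem_cube_one hx).1
  set φ : ℕ → Set (EuclideanSpace ℝ (Fin N)) := fun k => {y | 1 / ((k : ℝ) + 1) < y n} with hφ
  have hφm : ∀ k, MeasurableSet (φ k) := fun k =>
    (isOpen_lt continuous_const (by fun_prop)).measurableSet
  have hlim : ∀ y ∈ Q, ∀ᶠ k in Filter.atTop, y ∈ φ k := fun y hy =>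
    tendsto_one_div_add_atTop_nhds_zero_nat.eventually_lt_const (mem_Ioo_of_mem_cube_one hy).1
  have hcov : AECover (volume.restrict Q) Filter.atTop φ :=
    ⟨(ae_restrict_mem hQm).mono hlim, hφm⟩
  have hrestr : ∀ k, (volume.restrict Q).restrict (φ k) =
      volume.restrict (innerCube n (1 / ((k : ℝ) + 1))) := fun k => by
    rw [Measure.restrict_restrict (hφm k), inter_comm]; rfl
  have hk : ∀ k : ℕ, 0 < 1 / ((k : ℝ) + 1) ∧ 1 / ((k : ℝ) + 1) ≤ 1 := fun k =>
    ⟨by positivity, (div_le_one (by positivity)).2 (by linarith [k.cast_nonneg (α := ℝ)])⟩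
  have hbd : ∀ᶠ k in Filter.atTop,
      ∫ y in φ k, u y * y n ^ 3 ∂(volume.restrict Q) ≤ u x / (c * x n) := by
    filter_upwards [hlim x hx] with k hxk
    rw [hrestr, le_div_iff₀' (by positivity)]
    exact (key u hu hpos hlap _ (hk k).1 (hk k).2).2 x ⟨hx, hxk⟩
  have hint : ∀ k, IntegrableOn (fun y => u y * y n ^ 3) (φ k) (volume.restrict Q) := fun k => by
    rw [IntegrableOn, hrestr]
    exact (key u hu hpos hlap _ (hk k).1 (hk k).2).1
  have hI : Integrable (fun y => u y * y n ^ 3) (volume.restrict Q) := by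
    refine hcov.integrable_of_integral_bounded_of_nonneg_ae _ hint ?_ hbd
    filter_upwards [ae_restrict_mem hQm] with y hy
    exact mul_nonneg (hpos y (mem_cube_four_of_mem_cube_one hy))
      (pow_nonneg (mem_Ioo_of_mem_cube_one hy).1.le 3)
  refine ⟨hI, ?_⟩
  rw [← le_div_iff₀' (by positivity)]
  exact le_of_tendsto (hcov.integral_tendsto_of_countably_generated hI) hbd

lemma integrableOn_rpow_coord_cube (n : Fin N) :
    IntegrableOn (fun y => y n ^ (-(1 / 2) : ℝ))
      (cube 1 (EuclideanSpace.single n (1 / 2 : ℝ))) := by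
  set g : Fin N → ℝ → ℝ := fun i => if i = n then
    (Ioo (0 : ℝ) 1).indicator fun t => t ^ (-(1 / 2) : ℝ) else
    (Ioo (-(1 / 2) : ℝ) (1 / 2)).indicator 1
    with hg
  have hgi : ∀ i, Integrable (g i) := fun i => by
    simp only [hg]
    split_ifs
    · rw [integrable_indicator_iff measurableSet_Ioo]
      exact (intervalIntegral.integrableOn_Ioo_rpow_iff zero_lt_one).2 (by norm_num)
    · exact (integrable_indicator_iff measurableSet_Ioo).2
        (integrableOn_const (by simp) (by simp))
  have h1 : Integrable fun y : EuclideanSpace ℝ (Fin N) => ∏ i, g i (y i) :=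
    (EuclideanSpace.volume_preserving_symm_measurableEquiv_toLp (Fin N)).integrable_comp_emb
      (MeasurableEquiv.measurableEmbedding _) |>.2 (Integrable.fintype_prod hgi)
  refine h1.integrableOn.congr_fun (fun y hy => ?_) (isOpen_cube _ _).measurableSet
  have h2 : ∀ i, g i (y i) = if i = n then y n ^ (-(1 / 2) : ℝ) else 1 := fun i => by
    simp only [hg]
    split_ifs with hi
    · subst hi
      exact indicator_of_mem (mem_Ioo_of_mem_cube_one hy) _
    · exact indicator_of_mem (s := Ioo (-(1 / 2)) (1 / 2))
        (abs_lt.1 (abs_lt_of_mem_cube_one hy hi)) (1 : ℝ → ℝ)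
  simp [h2]

lemma div_rpow_le {v t V : ℝ} (hv : 0 ≤ v) (ht : 0 < t) (hV : 0 < V) :
    (v / t) ^ (1 / 9 : ℝ) ≤ V ^ (1 / 9 : ℝ) * (v * t ^ 3 / V + t ^ (-(1 / 2) : ℝ)) := by
  have hA : 0 ≤ v * t ^ 3 / V := by positivity
  have hT : 0 ≤ t ^ (-(1 / 2) : ℝ) := by positivity
  have h1 : v / t = V * ((v * t ^ 3 / V) * t ^ (-4 : ℝ)) := by
    rw [Real.rpow_neg ht.le]
    norm_cast
    field_simp
  have h2 : (t ^ (-4 : ℝ)) ^ (1 / 9 : ℝ) = (t ^ (-(1 / 2) : ℝ)) ^ (8 / 9 : ℝ) := by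
    rw [← Real.rpow_mul ht.le, ← Real.rpow_mul ht.le]
    norm_num
  rw [h1, Real.mul_rpow hV.le (by positivity), Real.mul_rpow hA (by positivity), h2]
  have h3 := Real.geom_mean_le_arith_mean2_weighted (w₁ := 1 / 9) (w₂ := 8 / 9) (by norm_num)
    (by norm_num) hA hT (by norm_num)
  exact mul_le_mul_of_nonneg_left (h3.trans (by linarith)) (by positivity)

end Boundary

/-- Boundary weak Harnack inequality for cubes (Theorem 3.7 for `p = 2`):
`Q_ρ := Q_ρ(ρe)` with `e = (0,…,0,1/2)`, so `Q_ρ = (-ρ/2,ρ/2)^{N-1} × (0,ρ)`. -/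
theorem stmt_6 {N : ℕ} (hN : 2 ≤ N) (a : ℝ) (ha : 0 ≤ a) :
    ∃ ε C : ℝ, 0 < ε ∧ 0 < C ∧
      ∀ u : EuclideanSpace ℝ (Fin N) → ℝ,
        ContDiffOn ℝ 2 u (cube 4 (EuclideanSpace.single (⟨N - 1, by omega⟩ : Fin N) 2)) →
        (∀ x ∈ cube 4 (EuclideanSpace.single (⟨N - 1, by omega⟩ : Fin N) 2), 0 ≤ u x) →
        (∀ x ∈ cube 4 (EuclideanSpace.single (⟨N - 1, by omega⟩ : Fin N) 2),
          0 ≤ -lap u x + a * u x) →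
        ∀ x ∈ cube 1 (EuclideanSpace.single (⟨N - 1, by omega⟩ : Fin N) (1 / 2)),
          C * (∫ y in cube 1 (EuclideanSpace.single (⟨N - 1, by omega⟩ : Fin N) (1 / 2)),
                (u y / y ⟨N - 1, by omega⟩) ^ ε) ^ (1 / ε)
            ≤ u x / x ⟨N - 1, by omega⟩ := by
  set n : Fin N := ⟨N - 1, by omega⟩
  obtain ⟨c, hc, key⟩ := exists_mul_setIntegral_cube_le n ha
  have hK := integrableOn_rpow_coord_cube n
  set Q : Set (EuclideanSpace ℝ (Fin N)) := cube 1 (EuclideanSpace.single n (1 / 2))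
  have hQm : MeasurableSet Q := (isOpen_cube _ _).measurableSet
  set K := ∫ y in Q, y n ^ (-(1 / 2) : ℝ)
  have hK0 : 0 ≤ K := setIntegral_nonneg hQm fun y hy =>
    Real.rpow_nonneg (mem_Ioo_of_mem_cube_one hy).1.le _
  refine ⟨1 / 9, c / (1 + K) ^ 9, by norm_num, by positivity, fun u hu hpos hlap x hx => ?_⟩
  obtain ⟨hJ, hJx⟩ := key u hu hpos hlap x hx
  have hxn := (mem_Ioo_of_mem_cube_one hx).1
  have hu0 : ∀ y ∈ Q, 0 ≤ u y := fun y hy => hpos y (mem_cube_four_of_mem_cube_one hy)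
  have hf0 : ∀ y ∈ Q, 0 ≤ (u y / y n) ^ (1 / 9 : ℝ) := fun y hy =>
    Real.rpow_nonneg (div_nonneg (hu0 y hy) (mem_Ioo_of_mem_cube_one hy).1.le) _
  set I := ∫ y in Q, (u y / y n) ^ (1 / 9 : ℝ)
  set J := ∫ y in Q, u y * y n ^ 3
  have hI0 : 0 ≤ I := setIntegral_nonneg hQm hf0
  have hm0 : 0 ≤ u x / x n := div_nonneg (hu0 x hx) hxn.le
  refine le_of_forall_pos_le_add fun δ hδ => ?_
  set V := (u x / x n + δ) / c with hV
  have hV0 : 0 < V := by positivity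
  have hJV : J ≤ V := by
    rw [hV, le_div_iff₀' hc]
    have : c * J ≤ u x / x n := by
      rw [le_div_iff₀ hxn]
      linarith
    linarith
  have hIV : I ≤ V ^ (1 / 9 : ℝ) * (1 + K) := by
    calc I ≤ ∫ y in Q, V ^ (1 / 9 : ℝ) * (u y * y n ^ 3 / V + y n ^ (-(1 / 2) : ℝ)) :=
          integral_mono_of_nonneg (ae_restrict_of_forall_mem hQm hf0)
            (((hJ.div_const V).add hK).const_mul _) (ae_restrict_of_forall_mem hQm fun y hy =>
              div_rpow_le (hu0 y hy) (mem_Ioo_of_mem_cube_one hy).1 hV0)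
      _ = V ^ (1 / 9 : ℝ) * (J / V + K) := by
          rw [integral_const_mul, integral_add (hJ.div_const V) hK, integral_div]
      _ ≤ _ := by
          have := (div_le_one hV0).2 hJV
          gcongr
  have hI9 : I ^ (9 : ℝ) ≤ V * (1 + K) ^ 9 := by
    calc I ^ (9 : ℝ) ≤ (V ^ (1 / 9 : ℝ) * (1 + K)) ^ (9 : ℝ) := by gcongr
      _ = _ := by
          rw [Real.mul_rpow (by positivity) (by positivity), ← Real.rpow_mul hV0.le]
          norm_num
  rw [one_div_one_div]
  calc c / (1 + K) ^ 9 * I ^ (9 : ℝ) ≤ c / (1 + K) ^ 9 * (V * (1 + K) ^ 9) := by gcongr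
    _ = u x / x n + δ := by
      rw [hV]
      field_simp
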